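/- There exists a constant C > 0 with the following property. Let F : S¹×S¹ → ℝ be measurable with ‖F‖²_{L²_od} := ∫_{S¹}∫_{S¹}|F(x,y)|² (dx dy/|x−y|) < ∞, and let g : S¹ → ℝ satisfy ‖g‖_{Ḣ^{1/2}} < ∞. Assume F is half-divergence free: ∫_{S¹}∫_{S¹} F(x,y)·(φ(x)−φ(y))/|x−y|^{3/2} dx dy = 0 for every φ ∈ C^∞(S¹;ℝ). Then there exists c ∈ ℝ such that for every φ ∈ C^∞(S¹;ℝ): |∫_{S¹} (F·d_{1/2}g)(x) φ(x) dx − c ∫_{S¹} φ(x) dx| ≤ C ‖F‖_{L²_od} ‖g‖_{H^{1/2}} ‖φ‖_{Ḣ^{1/2}}, where (F·d_{1/2}g)(x) := ∫_{S¹} F(x,y)(g(x)−g(y))/|x−y|^{3/2} dy. (That is, F·d_{1/2}g − c lies in H^{−1/2}(S¹) with norm controlled by ‖F‖_{L²_od}‖g‖_{H^{1/2}}.) -/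

import Mathlib

open MeasureTheory Real Filter
open scoped BigOperators ENNReal Real Topology

noncomputable section

/-- Chord distance on `S¹ ≃ ℝ/2πℤ`: `|x-y| = 2|sin((x-y)/2)|`. -/
def cd (x y : ℝ) : ℝ := 2 * |Real.sin ((x - y) / 2)|

/-- Fundamental domain for the circle `S¹ ≃ ℝ/2πℤ`. -/
def circ : Set ℝ := Set.Ioc (-π) π

/-- `k`-th Fourier coefficient of a `2π`-periodic function `ℝ → ℂ`. -/
def fc (f : ℝ → ℂ) (k : ℤ) : ℂ :=
  ((1 / (2 * π) : ℝ) : ℂ) * ∫ x in circ, f x * Complex.exp (-(Complex.I * (k : ℂ) * (x : ℂ)))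

/-- Fourier coefficient of a real-valued function. -/
def fcR (f : ℝ → ℝ) (k : ℤ) : ℂ := fc (fun x => (f x : ℂ)) k

/-- `ℝⁿ` as a Euclidean space. -/
abbrev E (n : ℕ) := EuclideanSpace ℝ (Fin n)

/-- Componentwise Fourier coefficients of a vector-valued map. -/
def fcV {n : ℕ} (u : ℝ → E n) (k : ℤ) (i : Fin n) : ℂ := fcR (fun x => u x i) k

/-- Squared homogeneous `Ḣ^{1/2}` seminorm: `∑_k |k| |û(k)|²` (valued in `[0,∞]`). -/
def hHalf {n : ℕ} (u : ℝ → E n) : ℝ≥0∞ :=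
  ∑' k : ℤ, (k.natAbs : ℝ≥0∞) * ∑ i, (‖fcV u k i‖₊ : ℝ≥0∞) ^ 2

/-- Squared inhomogeneous `H^s` norm: `∑_k (1+k²)^s |û(k)|²` (valued in `[0,∞]`). -/
def hSob {n : ℕ} (s : ℝ) (u : ℝ → E n) : ℝ≥0∞ :=
  ∑' k : ℤ, ENNReal.ofReal ((1 + (k : ℝ) ^ 2) ^ s) * ∑ i, (‖fcV u k i‖₊ : ℝ≥0∞) ^ 2

/-- Squared homogeneous `Ḣ^{1/2}` seminorm of a scalar function. -/
def hHalfR (f : ℝ → ℝ) : ℝ≥0∞ :=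
  ∑' k : ℤ, (k.natAbs : ℝ≥0∞) * (‖fcR f k‖₊ : ℝ≥0∞) ^ 2

/-- Squared inhomogeneous `H^s` norm of a scalar function. -/
def hSobR (s : ℝ) (f : ℝ → ℝ) : ℝ≥0∞ :=
  ∑' k : ℤ, ENNReal.ofReal ((1 + (k : ℝ) ^ 2) ^ s) * (‖fcR f k‖₊ : ℝ≥0∞) ^ 2

/-- `|d_{1/2}u|²(x) = ∫_{S¹} |u(x)-u(y)|²/|x-y|² dy`. -/
def gagl {n : ℕ} (u : ℝ → E n) (x : ℝ) : ℝ :=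
  ∫ y in circ, (∑ i, (u x i - u y i) ^ 2) / cd x y ^ 2

/-- `∫_{S¹}∫_{S¹} d_{1/2}u(x,y)·d_{1/2}φ(x,y) dy dx/|x-y|`. -/
def pairing {n : ℕ} (u φ : ℝ → E n) : ℝ :=
  ∫ x in circ, ∫ y in circ, (∑ i, (u x i - u y i) * (φ x i - φ y i)) / cd x y ^ 2

/-- The product measure on `(0,∞) × S¹`. -/
def STmeasure : Measure (ℝ × ℝ) :=
  (volume.restrict (Set.Ioi (0 : ℝ))).prod (volume.restrict circ)

/-- Smooth test functions on `(0,∞) × S¹`, compactly supported in time. -/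
structure IsSTTest (n : ℕ) (φ : ℝ → ℝ → E n) : Prop where
  smooth : ContDiff ℝ (⊤ : ℕ∞) (fun p : ℝ × ℝ => φ p.1 p.2)
  periodic : ∀ t, Function.Periodic (φ t) (2 * π)
  suppTime : ∃ a b : ℝ, 0 < a ∧ ∀ t, t ∉ Set.Icc a b → ∀ x, φ t x = 0

/-- Energy-class solution of the half-harmonic gradient flow, with explicit
weak time derivative `w`. -/
structure IsEnergySolAux (n : ℕ) (u₀ : ℝ → E n) (u w : ℝ → ℝ → E n) : Prop where
  meas : Measurable (Function.uncurry u)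
  periodic : ∀ t, Function.Periodic (u t) (2 * π)
  sphere : ∀ᵐ p ∂STmeasure, ‖u p.1 p.2‖ = 1
  energyBdd : ∃ M : ℝ≥0∞, M < ⊤ ∧
    ∀ᵐ t ∂(volume.restrict (Set.Ioi (0 : ℝ))), hHalf (u t) ≤ M
  wMeas : Measurable (Function.uncurry w)
  wL2 : (∫⁻ t in Set.Ioi (0 : ℝ), ∫⁻ x in circ, (‖w t x‖₊ : ℝ≥0∞) ^ 2) < ⊤
  weakDeriv : ∀ φ : ℝ → ℝ → E n, IsSTTest n φ →
    (∫ t in Set.Ioi (0 : ℝ), ∫ x in circ, ∑ i, u t x i * deriv (fun s => φ s x i) t)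
      = - ∫ t in Set.Ioi (0 : ℝ), ∫ x in circ, ∑ i, w t x i * φ t x i
  flow : ∀ φ : ℝ → ℝ → E n, IsSTTest n φ →
    (∫ t in Set.Ioi (0 : ℝ), ∫ x in circ, ∑ i, w t x i * φ t x i)
      + (∫ t in Set.Ioi (0 : ℝ), pairing (u t) (φ t))
      = ∫ t in Set.Ioi (0 : ℝ), ∫ x in circ, gagl (u t) x * ∑ i, u t x i * φ t x i
  init : Tendsto (fun t => ∫⁻ x in circ, (‖u t x - u₀ x‖₊ : ℝ≥0∞) ^ 2)
      (nhdsWithin 0 (Set.Ioi 0)) (nhds 0)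

/-- Energy-class solution of the half-harmonic gradient flow. -/
def IsEnergySol (n : ℕ) (u₀ : ℝ → E n) (u : ℝ → ℝ → E n) : Prop :=
  ∃ w, IsEnergySolAux n u₀ u w

/-- Energy decay: `‖u(t,·)‖_{Ḣ^{1/2}} ≤ ‖u₀‖_{Ḣ^{1/2}}` for a.e. `t ≥ 0`. -/
def EnergyDecay {n : ℕ} (u₀ : ℝ → E n) (u : ℝ → ℝ → E n) : Prop :=
  ∀ᵐ t ∂(volume.restrict (Set.Ioi (0 : ℝ))), hHalf (u t) ≤ hHalf u₀

/-- Fractional Laplacian `(-Δ)^s` of a `2π`-periodic function, via Fourier series. -/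
def fracLapC (s : ℝ) (f : ℝ → ℂ) (x : ℝ) : ℂ :=
  ∑' k : ℤ, (((k.natAbs : ℝ) ^ s : ℝ) : ℂ) * fc f k * Complex.exp (Complex.I * (k : ℂ) * (x : ℂ))

/-- Fractional Laplacian of a real-valued function. -/
def fracLapR (s : ℝ) (f : ℝ → ℝ) (x : ℝ) : ℝ := (fracLapC s (fun y => (f y : ℂ)) x).re

/-- Half-Laplacian of a vector-valued map. -/
def halfLap {n : ℕ} (u : ℝ → E n) (x : ℝ) : E n :=
  (EuclideanSpace.equiv (Fin n) ℝ).symm fun i => fracLapR 1 (fun y => u y i) x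

/-- The integral `C(j,k) = ∫_{-π}^{π} (e^{ijh}-1)(e^{ikh}-1)/(4sin²(h/2)) dh`. -/
def Cjk (j k : ℤ) : ℂ :=
  ∫ h in circ, (Complex.exp (Complex.I * (j : ℂ) * (h : ℂ)) - 1)
      * (Complex.exp (Complex.I * (k : ℂ) * (h : ℂ)) - 1)
      / ((4 * Real.sin (h / 2) ^ 2 : ℝ) : ℂ)

/-- A real trigonometric polynomial: the function equals a finite Fourier sum. -/
def IsTrigPoly (u : ℝ → ℝ) : Prop :=
  ∃ s : Finset ℤ, ∀ x : ℝ,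
    (u x : ℂ) = ∑ k ∈ s, fcR u k * Complex.exp (Complex.I * (k : ℂ) * (x : ℂ))

/-- `d_{1/2}u · d_{1/2}v` as a (complex-valued) function on the circle. -/
def d12prod (u v : ℝ → ℝ) (x : ℝ) : ℂ :=
  ((∫ y in circ, (u x - u y) * (v x - v y) / cd x y ^ 2 : ℝ) : ℂ)

/-- Stereographic projection of `S¹ ∖ {-i}`. -/
def stproj (θ : ℝ) : ℝ := Real.cos θ / (1 + Real.sin θ)


/-- The character `x ↦ e^{ikx}` of the circle. -/
def expC (k : ℤ) (x : ℝ) : ℂ := Complex.exp (Complex.I * (k : ℂ) * (x : ℂ))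

lemma continuous_expC (k : ℤ) : Continuous (expC k) := by
  unfold expC; fun_prop

lemma expC_add (j k : ℤ) (x : ℝ) : expC (j + k) x = expC j x * expC k x := by
  rw [expC, expC, expC, ← Complex.exp_add]; push_cast; ring_nf

lemma expC_sub_arg (k : ℤ) (x h : ℝ) : expC k (x - h) = expC k x * expC (-k) h := by
  rw [expC, expC, expC, ← Complex.exp_add]; push_cast; ring_nf

lemma expC_zero (x : ℝ) : expC 0 x = 1 := by simp [expC]

lemma expC_at_zero (k : ℤ) : expC k 0 = 1 := by simp [expC]

lemma norm_expC (k : ℤ) (x : ℝ) : ‖expC k x‖ = 1 := by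
  have : Complex.I * (k : ℂ) * (x : ℂ) = ((k * x : ℝ) : ℂ) * Complex.I := by push_cast; ring
  rw [expC, this, Complex.norm_exp_ofReal_mul_I]

lemma periodic_expC (k : ℤ) : Function.Periodic (expC k) (2 * π) := by
  intro x
  have : Complex.I * (k : ℂ) * ((x + 2 * π : ℝ) : ℂ)
      = Complex.I * (k : ℂ) * (x : ℂ) + k * (2 * π * Complex.I) := by push_cast; ring
  rw [expC, expC, this, Complex.exp_add, Complex.exp_int_mul_two_pi_mul_I, mul_one]

lemma hasDerivAt_expC (k : ℤ) (x : ℝ) :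
    HasDerivAt (expC k) (Complex.I * k * expC k x) x := by
  have h := ((hasDerivAt_id (x : ℂ)).const_mul (Complex.I * (k : ℂ))).cexp.comp_ofReal
  refine h.congr_deriv ?_
  simp [expC, mul_comm]

lemma circ_eq : circ = Set.Ioc (-π) (-π + 2 * π) := by
  rw [circ]; congr 1; ring

lemma measurableSet_circ : MeasurableSet circ := measurableSet_Ioc

instance isFiniteMeasure_circ : IsFiniteMeasure (volume.restrict circ) :=
  isFiniteMeasure_restrict_Ioc _ _

lemma lintegral_circ_comp_sub_left {f : ℝ → ℝ≥0∞} (hf : Function.Periodic f (2 * π)) (x : ℝ) :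
    ∫⁻ h in circ, f (x - h) = ∫⁻ y in circ, f y := by
  have : Fact (0 < 2 * π) := ⟨two_pi_pos⟩
  have h1 := AddCircle.lintegral_preimage (2 * π) (-π) hf.lift
  have h2 := AddCircle.lintegral_preimage (2 * π) (-π)
    (fun h => hf.lift ((x : AddCircle (2 * π)) - h))
  rw [lintegral_sub_left_eq_self] at h2
  rw [circ_eq]
  exact h2.trans h1.symm

lemma lintegral_circ_comp_sub_right {f : ℝ → ℝ≥0∞} (hf : Function.Periodic f (2 * π)) (x : ℝ) :
    ∫⁻ h in circ, f (h - x) = ∫⁻ y in circ, f y := by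
  have : Fact (0 < 2 * π) := ⟨two_pi_pos⟩
  have h1 := AddCircle.lintegral_preimage (2 * π) (-π) hf.lift
  have h2 := AddCircle.lintegral_preimage (2 * π) (-π)
    (fun h => hf.lift (h - (x : AddCircle (2 * π))))
  rw [lintegral_sub_right_eq_self] at h2
  rw [circ_eq]
  exact h2.trans h1.symm

lemma lintegral_circ_circ_eq_shift {H : ℝ → ℝ → ℝ≥0∞} (hm : Measurable (Function.uncurry H))
    (hH : ∀ x, Function.Periodic (H x) (2 * π)) :
    ∫⁻ x in circ, ∫⁻ y in circ, H x y = ∫⁻ h in circ, ∫⁻ x in circ, H x (x - h) := by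
  rw [lintegral_congr fun x => (lintegral_circ_comp_sub_left (hH x) x).symm,
    lintegral_lintegral_swap]
  exact (hm.comp (f := fun p : ℝ × ℝ => (p.1, p.1 - p.2)) (by fun_prop)).aemeasurable

lemma fc_eq_fourierCoeffOn (u : ℝ → ℂ) (k : ℤ) :
    fc u k = fourierCoeffOn (neg_lt_self pi_pos) u k := by
  rw [fourierCoeffOn_eq_integral, fc, intervalIntegral.integral_of_le (by linarith [pi_pos]),
    Complex.real_smul, circ]
  congr 1
  · norm_num; ring
  · refine setIntegral_congr_fun measurableSet_Ioc fun x _ => ?_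
    simp only [fourier_coe_apply, smul_eq_mul]
    rw [mul_comm]
    congr 2
    have : (π : ℂ) ≠ 0 := by exact_mod_cast pi_ne_zero
    push_cast
    field_simp
    ring

/-- Parseval's identity on the circle. -/
lemma lintegral_circ_enorm_sq {u : ℝ → ℂ} (hu : MemLp u 2 (volume.restrict circ)) :
    ∫⁻ x in circ, ‖u x‖ₑ ^ 2 = ENNReal.ofReal (2 * π) * ∑' k : ℤ, ‖fc u k‖ₑ ^ 2 := by
  have h := hasSum_sq_fourierCoeffOn (neg_lt_self pi_pos) hu
  have hi : Integrable (fun x => ‖u x‖ ^ 2) (volume.restrict circ) := hu.norm.integrable_sq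
  have e1 : ∫⁻ x in circ, ‖u x‖ₑ ^ 2 = ENNReal.ofReal (∫ x in circ, ‖u x‖ ^ 2) := by
    rw [ofReal_integral_eq_lintegral_ofReal hi (Eventually.of_forall fun x => by positivity)]
    simp [ENNReal.ofReal_pow, ofReal_norm]
  have e2 : ∑' k : ℤ, ‖fc u k‖ₑ ^ 2
      = ENNReal.ofReal ((π - -π)⁻¹ • ∫ x in (-π)..π, ‖u x‖ ^ 2) := by
    rw [← h.tsum_eq, ENNReal.ofReal_tsum_of_nonneg (fun _ => by positivity) h.summable]
    simp [ENNReal.ofReal_pow, ofReal_norm, fc_eq_fourierCoeffOn]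
  rw [e1, e2, ← ENNReal.ofReal_mul two_pi_pos.le,
    intervalIntegral.integral_of_le (by linarith [pi_pos])]
  congr 1
  have : π ≠ 0 := pi_ne_zero
  simp only [circ, smul_eq_mul]
  field_simp
  ring

lemma fc_expC (n k : ℤ) : fc (expC n) k = if n = k then 1 else 0 := by
  have e : ∀ x : ℝ, expC n x * Complex.exp (-(Complex.I * (k : ℂ) * (x : ℂ)))
      = Complex.exp ((Complex.I * ((n - k : ℤ) : ℂ)) * x) := by
    intro x; rw [expC, ← Complex.exp_add]; push_cast; ring_nf
  have hpi : (π : ℂ) ≠ 0 := by exact_mod_cast pi_ne_zero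
  rw [fc]
  simp_rw [e]
  rw [circ, ← intervalIntegral.integral_of_le (by linarith [pi_pos])]
  split_ifs with h
  · subst h
    simp
    field_simp
    norm_num
  · have h' : Complex.I * ((n - k : ℤ) : ℂ) ≠ 0 :=
      mul_ne_zero Complex.I_ne_zero (by exact_mod_cast sub_ne_zero.2 h)
    rw [integral_exp_mul_complex h']
    have h2 : expC (n - k) (-π + 2 * π) = expC (n - k) (-π) := periodic_expC _ _
    rw [show -π + 2 * π = π by ring] at h2
    rw [expC, expC] at h2
    rw [h2]
    simp

lemma fc_sum {ι : Type*} (s : Finset ι) (f : ι → ℝ → ℂ)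
    (hf : ∀ i ∈ s, IntegrableOn (f i) circ) (k : ℤ) :
    fc (fun x => ∑ i ∈ s, f i x) k = ∑ i ∈ s, fc (f i) k := by
  simp only [fc]
  simp_rw [Finset.sum_mul]
  rw [integral_finsetSum, Finset.mul_sum]
  intro i hi
  refine (hf i hi).mul_bdd (c := 1) (by fun_prop) (Eventually.of_forall fun x => ?_)
  have := norm_expC (-k) x
  rw [expC] at this
  simpa using this.le

lemma fc_const_mul (c : ℂ) (f : ℝ → ℂ) (k : ℤ) :
    fc (fun x => c * f x) k = c * fc f k := by
  simp only [fc, mul_assoc]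
  rw [integral_const_mul]
  ring

lemma Continuous.memLp_circ {f : ℝ → ℂ} (hf : Continuous f) (p : ℝ≥0∞) :
    MemLp f p (volume.restrict circ) := by
  obtain ⟨C, hC⟩ := (isCompact_Icc (a := -π) (b := π)).exists_bound_of_continuousOn hf.continuousOn
  refine MemLp.of_bound hf.aestronglyMeasurable C ?_
  refine ae_restrict_of_forall_mem measurableSet_circ fun x hx => hC x ⟨hx.1.le, hx.2⟩

lemma Continuous.integrableOn_circ {f : ℝ → ℂ} (hf : Continuous f) : IntegrableOn f circ :=
  memLp_one_iff_integrable.1 (hf.memLp_circ 1)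

lemma fc_trig {ι : Type*} (s : Finset ι) (c : ι → ℂ) (κ : ι → ℤ) (k : ℤ) :
    fc (fun x => ∑ i ∈ s, c i * expC (κ i) x) k = ∑ i ∈ s, if κ i = k then c i else 0 := by
  rw [fc_sum s (fun i x => c i * expC (κ i) x)
    (fun i _ => (continuous_const.mul (continuous_expC _)).integrableOn_circ)]
  simp [fc_const_mul, fc_expC]

lemma lintegral_circ_trig {ι : Type*} (s : Finset ι) (c : ι → ℂ) {κ : ι → ℤ}
    (hκ : Set.InjOn κ s) :
    ∫⁻ x in circ, ‖∑ i ∈ s, c i * expC (κ i) x‖ₑ ^ 2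
      = ENNReal.ofReal (2 * π) * ∑ i ∈ s, ‖c i‖ₑ ^ 2 := by
  classical
  have hc : Continuous fun x => ∑ i ∈ s, c i * expC (κ i) x :=
    continuous_finsetSum _ fun i _ => continuous_const.mul (continuous_expC _)
  rw [lintegral_circ_enorm_sq (hc.memLp_circ 2)]
  congr 1
  simp_rw [fc_trig]
  rw [tsum_eq_sum (s := s.image κ), Finset.sum_image hκ]
  · refine Finset.sum_congr rfl fun i hi => ?_
    rw [Finset.sum_eq_single_of_mem i hi]
    · simp
    · intro j hj hji
      exact if_neg fun h => hji (hκ hj hi h)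
  · intro k hk
    rw [Finset.sum_eq_zero]
    · simp
    · intro i hi
      exact if_neg fun h : κ i = k => hk (h ▸ Finset.mem_image_of_mem κ hi)

lemma cd_nonneg (x y : ℝ) : 0 ≤ cd x y := by unfold cd; positivity

lemma continuous_cd : Continuous fun p : ℝ × ℝ => cd p.1 p.2 := by
  unfold cd; fun_prop

lemma cd_comm (x y : ℝ) : cd x y = cd y x := by
  rw [cd, cd, ← abs_neg, ← Real.sin_neg]; ring_nf

lemma cd_sub_self (x h : ℝ) : cd x (x - h) = cd h 0 := by
  rw [cd, cd]; ring_nf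

lemma periodic_cd_right (x : ℝ) : Function.Periodic (cd x) (2 * π) := by
  intro y
  rw [cd, cd, show (x - (y + 2 * π)) / 2 = (x - y) / 2 - π by ring, Real.sin_sub_pi, abs_neg]

lemma abs_le_cd_zero {h : ℝ} (hh : |h| ≤ π) : 2 / π * |h| ≤ cd h 0 := by
  have := Real.mul_abs_le_abs_sin (x := h / 2) (by rw [abs_div]; norm_num; linarith)
  rw [abs_div, abs_two] at this
  rw [cd, sub_zero]
  linarith

lemma enorm_sq_eq_ofReal (z : ℂ) : ‖z‖ₑ ^ 2 = ENNReal.ofReal (‖z‖ ^ 2) := by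
  rw [ENNReal.ofReal_pow (norm_nonneg _), ofReal_norm]

/-- Hardy's inequality on the circle. -/
lemma lintegral_circ_hardy {v v' : ℝ → ℂ} (hv : ∀ x, HasDerivAt v (v' x) x)
    (hv' : Continuous v') (h0 : v 0 = 0) :
    ∫⁻ h in circ, ‖v h / (cd h 0 : ℂ)‖ₑ ^ 2 ≤ 4 * ∫⁻ h in circ, ‖v' h‖ₑ ^ 2 := by
  obtain ⟨M, hM⟩ :=
    (isCompact_Icc (a := -π) (b := π)).exists_bound_of_continuousOn hv'.continuousOn
  have hM0 : 0 ≤ M := (norm_nonneg _).trans (hM 0 ⟨by linarith [pi_pos], pi_pos.le⟩)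
  have hvc : Continuous v := continuous_iff_continuousAt.2 fun x => (hv x).continuousAt
  have hvM : ∀ h ∈ Set.Icc (-π) π, ‖v h‖ ≤ M * |h| := by
    intro h hh
    have := (convex_Icc (-π) π).norm_image_sub_le_of_norm_hasDerivWithin_le
      (f := v) (f' := v') (C := M) (fun x _ => (hv x).hasDerivWithinAt) hM
      (x := 0) (y := h) ⟨by linarith [pi_pos], pi_pos.le⟩ hh
    simpa [h0] using this
  set X : ℝ → ℝ := fun h => ‖v h‖ / cd h 0 with hX
  have hXm : Measurable X :=
    hvc.norm.measurable.div (continuous_cd.comp (by fun_prop : Continuous fun h : ℝ => (h, (0 : ℝ)))).measurable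
  have hX0 : ∀ h, 0 ≤ X h := fun h => div_nonneg (norm_nonneg _) (cd_nonneg _ _)
  have hcdpos : ∀ h ∈ Set.Icc (-π) π, h ≠ 0 → 0 < cd h 0 := by
    intro h hh hne
    have := abs_le_cd_zero (abs_le.2 hh)
    have h2 : 0 < 2 / π * |h| := mul_pos (div_pos two_pos pi_pos) (abs_pos.2 hne)
    linarith
  have hXM : ∀ h ∈ Set.Icc (-π) π, X h ≤ M * π / 2 := by
    intro h hh
    rcases eq_or_ne h 0 with rfl | hne
    · simp only [hX, h0, norm_zero, zero_div]; positivity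
    · rw [hX, div_le_iff₀ (hcdpos h hh hne)]
      calc ‖v h‖ ≤ M * |h| := hvM h hh
        _ = M * π / 2 * (2 / π * |h|) := by field_simp
        _ ≤ _ := by gcongr; exact abs_le_cd_zero (abs_le.2 hh)
  set G : ℝ → ℝ := fun h => -(Real.cos (h / 2) / (2 * Real.sin (h / 2))) * ‖v h‖ ^ 2 with hG
  set R : ℝ → ℝ := fun h =>
    Real.cos (h / 2) / Real.sin (h / 2) * inner ℝ (v h) (v' h) with hR
  have hRle : ∀ h, |R h| ≤ 2 * X h * ‖v' h‖ := by
    intro h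
    rw [hR, abs_mul, abs_div]
    have h1 := Real.abs_cos_le_one (h / 2)
    have h2 := abs_real_inner_le_norm (v h) (v' h)
    calc |Real.cos (h / 2)| / |Real.sin (h / 2)| * |inner ℝ (v h) (v' h)|
        ≤ 1 / |Real.sin (h / 2)| * (‖v h‖ * ‖v' h‖) := by gcongr
      _ = 2 * X h * ‖v' h‖ := by
        simp only [hX, cd, sub_zero]
        rcases eq_or_ne (Real.sin (h / 2)) 0 with hs | hs
        · simp [hs]
        · have := abs_pos.2 hs
          field_simp
  have hRm : Measurable R := by
    have : Continuous fun h => inner ℝ (v h) (v' h) := hvc.inner hv'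
    exact ((by fun_prop : Measurable fun h : ℝ => Real.cos (h / 2)).div
      (by fun_prop : Measurable fun h : ℝ => Real.sin (h / 2))).mul this.measurable
  have hXi : Integrable (fun h => X h ^ 2) (volume.restrict circ) := by
    refine Measure.integrableOn_of_bounded (M := (M * π / 2) ^ 2) ?_ (hXm.pow_const 2).aestronglyMeasurable ?_
    · exact measure_Ioc_lt_top.ne
    · refine ae_restrict_of_forall_mem measurableSet_circ fun h hh => ?_
      rw [Real.norm_of_nonneg (by positivity)]
      exact pow_le_pow_left₀ (hX0 h) (hXM h ⟨hh.1.le, hh.2⟩) 2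
  have hRi : Integrable R (volume.restrict circ) := by
    refine Measure.integrableOn_of_bounded (M := 2 * (M * π / 2) * M) ?_ hRm.aestronglyMeasurable ?_
    · exact measure_Ioc_lt_top.ne
    · refine ae_restrict_of_forall_mem measurableSet_circ fun h hh => ?_
      have hh' : h ∈ Set.Icc (-π) π := ⟨hh.1.le, hh.2⟩
      refine (hRle h).trans ?_
      have := hXM h hh'
      have := hM h hh'
      gcongr
  have hvi : Integrable (fun h => ‖v' h‖ ^ 2) (volume.restrict circ) :=
    (hv'.memLp_circ 2).norm.integrable_sq
  have hGd : ∀ h ∈ Set.Ioo (-π) π \ {0}, HasDerivAt G (X h ^ 2 - R h) h := by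
    rintro h ⟨hh, hne⟩
    have hne : h ≠ 0 := hne
    have hc := hcdpos h ⟨hh.1.le, hh.2.le⟩ hne
    have hs : Real.sin (h / 2) ≠ 0 := by
      intro hs; rw [cd, sub_zero, hs] at hc; simp at hc
    have hd : HasDerivAt (fun h : ℝ => h / 2) (1 / 2) h := (hasDerivAt_id h).div_const 2
    have h1 := ((hd.cos).div (hd.sin.const_mul 2) (mul_ne_zero two_ne_zero hs)).neg.mul
      (hv h).norm_sq
    refine h1.congr_deriv ?_
    have hcs := Real.sin_sq_add_cos_sq (h / 2)
    simp only [hX, hR, cd, sub_zero, div_pow, mul_pow, sq_abs, Pi.neg_apply, Pi.div_apply]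
    field_simp
    linear_combination (‖v h‖ ^ 2) * hcs
  have hGc : ContinuousOn G (Set.Icc (-π) π) := by
    intro h hh
    rcases eq_or_ne h 0 with rfl | hne
    · have hG0 : G 0 = 0 := by simp [hG, h0]
      rw [ContinuousWithinAt, hG0]
      refine squeeze_zero_norm' (a := fun h => M * π / 2 * (M * |h|)) ?_ ?_
      · filter_upwards [self_mem_nhdsWithin] with h hh
        have e : ‖G h‖ ≤ X h * ‖v h‖ := by
          rw [hG, norm_mul, norm_neg, norm_div, norm_mul, Real.norm_two, Real.norm_eq_abs,
            Real.norm_eq_abs, norm_pow, norm_norm]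
          have h1 := Real.abs_cos_le_one (h / 2)
          calc |Real.cos (h / 2)| / (2 * |Real.sin (h / 2)|) * ‖v h‖ ^ 2
              ≤ 1 / (2 * |Real.sin (h / 2)|) * ‖v h‖ ^ 2 := by gcongr
            _ = X h * ‖v h‖ := by simp only [hX, cd, sub_zero]; ring
        refine e.trans ?_
        have := hXM h hh
        have := hvM h hh
        have := hX0 h
        gcongr
      · have : Continuous fun h : ℝ => M * π / 2 * (M * |h|) := by fun_prop
        simpa using (this.tendsto 0).mono_left nhdsWithin_le_nhds
    · have hc := hcdpos h hh hne
      have hs : 2 * Real.sin (h / 2) ≠ 0 := by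
        intro hs
        have hs : Real.sin (h / 2) = 0 := by linarith
        rw [cd, sub_zero, hs] at hc; simp at hc
      refine ContinuousAt.continuousWithinAt ?_
      refine ContinuousAt.mul (ContinuousAt.neg (ContinuousAt.div ?_ ?_ hs)) ?_
      · fun_prop
      · fun_prop
      · exact (hvc.norm.pow 2).continuousAt
  have hle : -π ≤ π := by linarith [pi_pos]
  have hint : ∫ h in circ, (X h ^ 2 - R h) = 0 := by
    rw [circ, ← intervalIntegral.integral_of_le hle,
      integral_eq_of_hasDerivAt_off_countable_of_le G _ hle (Set.countable_singleton 0) hGc hGd]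
    · have e : -π / 2 = -(π / 2) := by ring
      simp [hG, e]
    · rw [intervalIntegrable_iff_integrableOn_Ioc_of_le hle]
      exact hXi.sub hRi
  have key : ∫ h in circ, X h ^ 2 ≤ 4 * ∫ h in circ, ‖v' h‖ ^ 2 := by
    rw [integral_sub hXi hRi, sub_eq_zero] at hint
    have : ∫ h in circ, R h ≤ ∫ h in circ, (1 / 2 * X h ^ 2 + 2 * ‖v' h‖ ^ 2) := by
      refine integral_mono hRi ((hXi.const_mul _).add (hvi.const_mul _)) fun h => ?_
      have h1 := (le_abs_self _).trans (hRle h)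
      have h2 := sq_nonneg (X h - 2 * ‖v' h‖)
      simp only
      nlinarith
    rw [integral_add (hXi.const_mul _) (hvi.const_mul _), integral_const_mul,
      integral_const_mul] at this
    linarith
  have hnorm : ∀ h, ‖v h / (cd h 0 : ℂ)‖ = X h := by
    intro h
    rw [norm_div, Complex.norm_of_nonneg (cd_nonneg _ _)]
  simp_rw [enorm_sq_eq_ofReal, hnorm]
  rw [← ofReal_integral_eq_lintegral_ofReal hXi (Eventually.of_forall fun _ => by positivity),
    ← ofReal_integral_eq_lintegral_ofReal hvi (Eventually.of_forall fun _ => by positivity),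
    show (4 : ℝ≥0∞) = ENNReal.ofReal 4 by simp, ← ENNReal.ofReal_mul (by norm_num)]
  exact ENNReal.ofReal_le_ofReal key

/-- The squared norm of `(x, y) ↦ W x y / |x - y|` in `L²(S¹ × S¹)`. -/
def chordEnergy (W : ℝ → ℝ → ℂ) : ℝ≥0∞ :=
  ∫⁻ x in circ, ∫⁻ y in circ, ‖W x y / (cd x y : ℂ)‖ₑ ^ 2

lemma measurable_div_cd {W : ℝ → ℝ → ℂ} (hW : Measurable (Function.uncurry W)) :
    Measurable (Function.uncurry fun x y => W x y / (cd x y : ℂ)) :=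
  hW.div (Complex.continuous_ofReal.comp continuous_cd).measurable

lemma chordEnergy_swap {W : ℝ → ℝ → ℂ} (hW : Measurable (Function.uncurry W)) :
    chordEnergy (fun x y => W y x) = chordEnergy W := by
  rw [chordEnergy, chordEnergy, lintegral_lintegral_swap]
  · simp_rw [cd_comm]
  · exact (((measurable_div_cd (W := fun x y => W y x)
      (hW.comp measurable_swap)).enorm).pow_const 2).aemeasurable

lemma chordEnergy_eq_shift {W : ℝ → ℝ → ℂ} (hW : Measurable (Function.uncurry W))
    (hp : ∀ x, Function.Periodic (W x) (2 * π)) :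
    chordEnergy W
      = ∫⁻ h in circ, ∫⁻ x in circ, ‖W x (x - h) / (cd h 0 : ℂ)‖ₑ ^ 2 := by
  rw [chordEnergy, lintegral_circ_circ_eq_shift]
  · simp_rw [cd_sub_self]
  · exact (measurable_div_cd hW).enorm.pow_const 2
  · intro x y
    simp only [hp x y, periodic_cd_right x y]

lemma integral_circ_comp_sub_right {f : ℝ → ℂ} (hf : Function.Periodic f (2 * π)) (x : ℝ) :
    ∫ h in circ, f (h - x) = ∫ y in circ, f y := by
  have : Fact (0 < 2 * π) := ⟨two_pi_pos⟩
  have h1 := AddCircle.integral_preimage (2 * π) (-π) hf.lift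
  have h2 := AddCircle.integral_preimage (2 * π) (-π)
    (fun h => hf.lift (h - (x : AddCircle (2 * π))))
  rw [integral_sub_right_eq_self] at h2
  rw [circ_eq]
  exact h2.trans h1.symm

lemma exp_neg_eq_expC (k : ℤ) (x : ℝ) :
    Complex.exp (-(Complex.I * (k : ℂ) * (x : ℂ))) = expC (-k) x := by
  rw [expC]; push_cast; ring_nf

lemma fc_comp_sub {u : ℝ → ℂ} (hu : Function.Periodic u (2 * π)) (h : ℝ) (k : ℤ) :
    fc (fun x => u (x - h)) k = expC (-k) h * fc u k := by
  have hp : Function.Periodic (fun x => u x * expC (-k) x) (2 * π) := fun x => by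
    simp only [hu x, periodic_expC _ x]
  have e : ∀ x, u (x - h) * expC (-k) x = expC (-k) h * (u (x - h) * expC (-k) (x - h)) := by
    intro x
    conv_lhs => rw [← sub_add_cancel x h]
    have : expC (-k) (x - h + h) = expC (-k) (x - h) * expC (-k) h := by
      rw [expC, expC, expC, ← Complex.exp_add]; push_cast; ring_nf
    rw [this, sub_add_cancel]; ring
  simp only [fc, exp_neg_eq_expC]
  simp_rw [e]
  rw [integral_const_mul, integral_circ_comp_sub_right hp h]
  ring

lemma fc_sub {u v : ℝ → ℂ} (hu : IntegrableOn u circ) (hv : IntegrableOn v circ) (k : ℤ) :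
    fc (fun x => u x - v x) k = fc u k - fc v k := by
  have hm : ∀ {w : ℝ → ℂ}, IntegrableOn w circ →
      IntegrableOn (fun x => w x * expC (-k) x) circ := fun hw =>
    hw.mul_bdd (c := 1) (continuous_expC _).aestronglyMeasurable
      (Eventually.of_forall fun x => (norm_expC _ _).le)
  simp only [fc, exp_neg_eq_expC, sub_mul]
  rw [integral_sub (hm hu) (hm hv)]
  ring

lemma memLp_comp_sub {u : ℝ → ℂ} (hm : Measurable u) (hu : Function.Periodic u (2 * π))
    (h2 : MemLp u 2 (volume.restrict circ)) (h : ℝ) :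
    MemLp (fun x => u (x - h)) 2 (volume.restrict circ) := by
  refine ⟨(hm.comp (measurable_id.sub_const h)).aestronglyMeasurable, ?_⟩
  have h2 := h2.2
  rw [eLpNorm_lt_top_iff_lintegral_rpow_enorm_lt_top two_ne_zero ENNReal.ofNat_ne_top] at h2 ⊢
  refine lt_of_eq_of_lt ?_ h2
  exact lintegral_circ_comp_sub_right (f := fun x => ‖u x‖ₑ ^ (2 : ℝ≥0∞).toReal)
    (fun x => by simp only [hu x]) h

lemma norm_one_sub_expC_one (h : ℝ) : ‖1 - expC 1 h‖ = cd h 0 := by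
  rw [norm_sub_rev, expC, cd, sub_zero]
  have := Complex.norm_exp_I_mul_ofReal_sub_one h
  simpa using this

lemma norm_one_sub_expC_neg (k : ℤ) (h : ℝ) : ‖1 - expC (-k) h‖ = ‖1 - expC k h‖ := by
  have : 1 - expC (-k) h = -(expC (-k) h * (1 - expC k h)) := by
    rw [mul_sub, ← expC_add]; simp [expC_zero]
  rw [this, norm_neg, norm_mul, norm_expC, one_mul]

lemma lintegral_circ_one_sub_expC_le (k : ℤ) :
    ∫⁻ h in circ, ‖(1 - expC (-k) h) / (cd h 0 : ℂ)‖ₑ ^ 2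
      ≤ ENNReal.ofReal (2 * π) * (k.natAbs : ℝ≥0∞) := by
  have e : ∀ h, ‖(1 - expC (-k) h) / (cd h 0 : ℂ)‖
      ≤ ‖∑ n ∈ Finset.range k.natAbs, (1 : ℂ) * expC (n : ℤ) h‖ := by
    intro h
    have h1 : ‖1 - expC (-k) h‖ = ‖1 - expC (k.natAbs : ℤ) h‖ := by
      rcases Int.natAbs_eq k with hk | hk
      · rw [norm_one_sub_expC_neg, ← hk]
      · nth_rw 1 [hk]
        rw [neg_neg]
    have hpow : ∀ n : ℕ, expC (n : ℤ) h = expC 1 h ^ n := by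
      intro n
      rw [expC, expC, ← Complex.exp_nat_mul]; push_cast; ring_nf
    rw [norm_div, Complex.norm_of_nonneg (cd_nonneg _ _), h1]
    refine div_le_of_le_mul₀ (cd_nonneg _ _) (norm_nonneg _) ?_
    rw [← norm_one_sub_expC_one, ← norm_mul]
    simp_rw [one_mul, hpow]
    rw [geom_sum_mul_neg]
  calc _ ≤ ∫⁻ h in circ, ‖∑ n ∈ Finset.range k.natAbs, (1 : ℂ) * expC (n : ℤ) h‖ₑ ^ 2 := by
        refine lintegral_mono fun h => ?_
        simp only [enorm_sq_eq_ofReal]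
        exact ENNReal.ofReal_le_ofReal (pow_le_pow_left₀ (norm_nonneg _) (e h) 2)
    _ = _ := by
        rw [lintegral_circ_trig (Finset.range k.natAbs) (fun _ => 1) (κ := fun n => (n : ℤ))
          Nat.cast_injective.injOn]
        simp

/-- The Gagliardo energy is controlled by the homogeneous `Ḣ^{1/2}` seminorm. -/
lemma chordEnergy_sub_le {u : ℝ → ℂ} (hm : Measurable u) (hu : Function.Periodic u (2 * π))
    (h2 : MemLp u 2 (volume.restrict circ)) :
    chordEnergy (fun x y => u x - u y)
      ≤ ENNReal.ofReal (2 * π) ^ 2 * ∑' k : ℤ, (k.natAbs : ℝ≥0∞) * ‖fc u k‖ₑ ^ 2 := by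
  rw [chordEnergy_eq_shift]
  · have e : ∀ h, ∫⁻ x in circ, ‖(u x - u (x - h)) / (cd h 0 : ℂ)‖ₑ ^ 2
        = ENNReal.ofReal (2 * π)
          * ∑' k : ℤ, ‖(1 - expC (-k) h) / (cd h 0 : ℂ)‖ₑ ^ 2 * ‖fc u k‖ₑ ^ 2 := by
      intro h
      have hs := memLp_comp_sub hm hu h2 h
      have := lintegral_circ_enorm_sq ((h2.sub hs).const_mul ((cd h 0 : ℂ)⁻¹))
      simp only [Pi.sub_apply] at this
      simp_rw [div_eq_inv_mul]
      rw [this]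
      congr 2
      ext k
      rw [fc_const_mul, fc_sub (h2.integrable one_le_two) (hs.integrable one_le_two),
        fc_comp_sub hu, ← mul_pow, ← enorm_mul]
      congr 2
      ring
    simp_rw [e]
    have hmeas : ∀ k : ℤ, Measurable fun h => ‖(1 - expC (-k) h) / (cd h 0 : ℂ)‖ₑ ^ 2 :=
      fun k => (((continuous_const.sub (continuous_expC (-k))).measurable.div
        (Complex.continuous_ofReal.comp (continuous_cd.comp
          (by fun_prop : Continuous fun h : ℝ => (h, (0 : ℝ))))).measurable).enorm.pow_const 2)
    rw [lintegral_const_mul _ (Measurable.tsum fun k => (hmeas k).mul_const _),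
      lintegral_tsum fun k => ((hmeas k).mul_const _).aemeasurable, pow_two, mul_assoc]
    gcongr
    rw [← ENNReal.tsum_mul_left]
    refine ENNReal.tsum_le_tsum fun k => ?_
    rw [lintegral_mul_const _ (hmeas k), ← mul_assoc]
    gcongr
    exact lintegral_circ_one_sub_expC_le k
  · exact (hm.comp measurable_fst).sub (hm.comp measurable_snd)
  · intro x y
    simp only [hu y]

lemma chordEnergy_trig_le (S : Finset (ℤ × ℤ)) (c : ℤ × ℤ → ℂ) :
    chordEnergy (fun x y => ∑ p ∈ S, c p * (expC p.1 x * (expC p.2 x - expC p.2 y)))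
      ≤ 4 * ENNReal.ofReal (2 * π) ^ 2
        * ∑ p ∈ S, ((p.2.natAbs : ℝ≥0∞) ^ 2 * ‖c p‖ₑ ^ 2) := by
  set M := S.image fun p => p.1 + p.2 with hM
  set V : ℤ → ℝ → ℂ := fun m h =>
    ∑ p ∈ S with p.1 + p.2 = m, c p * (1 - expC (-p.2) h) with hV
  set V' : ℤ → ℝ → ℂ := fun m h =>
    ∑ p ∈ S with p.1 + p.2 = m, (c p * (Complex.I * p.2)) * expC (-p.2) h with hV'
  have hVd : ∀ m h, HasDerivAt (V m) (V' m h) h := by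
    intro m h
    refine HasDerivAt.fun_sum fun p _ => ?_
    refine (((hasDerivAt_const h (1 : ℂ)).sub (hasDerivAt_expC (-p.2) h)).const_mul (c p)).congr_deriv ?_
    push_cast
    ring
  have hV'c : ∀ m, Continuous (V' m) := fun m =>
    continuous_finsetSum _ fun p _ => continuous_const.mul (continuous_expC _)
  have hVm : ∀ m, Measurable fun h => ‖V m h / (cd h 0 : ℂ)‖ₑ ^ 2 := fun m =>
    ((continuous_iff_continuousAt.2 fun h => (hVd m h).continuousAt).measurable.div
        (Complex.continuous_ofReal.comp (continuous_cd.comp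
          (by fun_prop : Continuous fun h : ℝ => (h, (0 : ℝ))))).measurable).enorm.pow_const 2
  have hmaps : ∀ p ∈ S, p.1 + p.2 ∈ M := fun p hp => Finset.mem_image_of_mem _ hp
  rw [chordEnergy_eq_shift]
  · have e : ∀ h x, (∑ p ∈ S, c p * (expC p.1 x * (expC p.2 x - expC p.2 (x - h)))) / (cd h 0 : ℂ)
        = ∑ m ∈ M, V m h / (cd h 0 : ℂ) * expC m x := by
      intro h x
      rw [← Finset.sum_fiberwise_of_maps_to hmaps, Finset.sum_div]
      refine Finset.sum_congr rfl fun m _ => ?_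
      rw [div_mul_eq_mul_div, hV, Finset.sum_mul]
      congr 1
      refine Finset.sum_congr rfl fun p hp => ?_
      rw [← (Finset.mem_filter.1 hp).2, expC_add, expC_sub_arg]
      ring
    simp_rw [e, lintegral_circ_trig M (fun m => V m _ / (cd _ 0 : ℂ)) (κ := fun m => m)
      (fun _ _ _ _ h => h)]
    rw [lintegral_const_mul _ (Finset.measurable_fun_sum _ fun m _ => hVm m),
      lintegral_finsetSum _ fun m _ => hVm m]
    have hb : ∀ m ∈ M, ∫⁻ h in circ, ‖V m h / (cd h 0 : ℂ)‖ₑ ^ 2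
        ≤ 4 * (ENNReal.ofReal (2 * π)
          * ∑ p ∈ S with p.1 + p.2 = m, ((p.2.natAbs : ℝ≥0∞) ^ 2 * ‖c p‖ₑ ^ 2)) := by
      intro m _
      refine (lintegral_circ_hardy (hVd m) (hV'c m) (by simp [hV, expC_at_zero])).trans_eq ?_
      rw [hV', lintegral_circ_trig _ (fun p => c p * (Complex.I * p.2)) (κ := fun p => -p.2)]
      · congr 2
        refine Finset.sum_congr rfl fun p _ => ?_
        rw [enorm_mul, enorm_mul, mul_pow, mul_comm]
        congr 2
        rw [← ofReal_norm Complex.I, Complex.norm_I, ENNReal.ofReal_one, one_mul, ← ofReal_norm,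
          Complex.norm_intCast, ← Int.cast_abs, Int.abs_eq_natAbs,
          Int.cast_natCast, ENNReal.ofReal_natCast]
      · intro p hp q hq hpq
        have hp := (Finset.mem_filter.1 hp).2
        have hq := (Finset.mem_filter.1 hq).2
        simp only [neg_inj] at hpq
        ext
        · omega
        · exact hpq
    calc _ ≤ ENNReal.ofReal (2 * π) * ∑ m ∈ M, 4 * (ENNReal.ofReal (2 * π)
          * ∑ p ∈ S with p.1 + p.2 = m, ((p.2.natAbs : ℝ≥0∞) ^ 2 * ‖c p‖ₑ ^ 2)) := by
          gcongr with m hm; exact hb m hm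
      _ = _ := by
          rw [← Finset.mul_sum, ← Finset.mul_sum, Finset.sum_fiberwise_of_maps_to hmaps]
          ring
  · refine Finset.measurable_fun_sum _ fun p _ => ?_
    have h1 := (continuous_expC p.1).measurable
    have h2 := (continuous_expC p.2).measurable
    exact ((h1.comp measurable_fst).mul ((h2.comp measurable_fst).sub
      (h2.comp measurable_snd))).const_mul _
  · intro x y
    simp only [periodic_expC _ y]

lemma fc_eq_fc_deriv_div {f f' : ℝ → ℂ} (hf : ∀ x, HasDerivAt f (f' x) x) (hf' : Continuous f')
    (hp : Function.Periodic f (2 * π)) {k : ℤ} (hk : k ≠ 0) :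
    fc f k = fc f' k / (Complex.I * k) := by
  have h := fourierCoeffOn_of_hasDerivAt (neg_lt_self pi_pos) hk (fun x _ => hf x)
    (hf'.intervalIntegrable (-π) π)
  have hpi : f π = f (-π) := by
    rw [← hp (-π)]; congr 1; ring
  have hpi0 : (π : ℂ) ≠ 0 := by exact_mod_cast pi_ne_zero
  have hk0 : (k : ℂ) ≠ 0 := by exact_mod_cast hk
  have hI : Complex.I ≠ 0 := Complex.I_ne_zero
  rw [fc_eq_fourierCoeffOn, fc_eq_fourierCoeffOn, h, hpi]
  push_cast
  field_simp
  ring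

lemma norm_fc_le {u : ℝ → ℂ} (k : ℤ) : ‖fc u k‖ ≤ 1 / (2 * π) * ∫ x in circ, ‖u x‖ := by
  have h0 : (0 : ℝ) ≤ 1 / (2 * π) := by positivity
  rw [fc, norm_mul, Complex.norm_of_nonneg h0]
  gcongr
  refine (norm_integral_le_integral_norm _).trans_eq ?_
  simp_rw [exp_neg_eq_expC, norm_mul, norm_expC, mul_one]

lemma summable_norm_fc {f f' f'' : ℝ → ℂ} (hf : ∀ x, HasDerivAt f (f' x) x)
    (hf' : ∀ x, HasDerivAt f' (f'' x) x) (hf'' : Continuous f'')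
    (hp : Function.Periodic f (2 * π)) (hp' : Function.Periodic f' (2 * π)) :
    Summable fun k => ‖fc f k‖ := by
  have hc' : Continuous f' := continuous_iff_continuousAt.2 fun x => (hf' x).continuousAt
  set B := 1 / (2 * π) * ∫ x in circ, ‖f'' x‖ with hB
  have hs : Summable fun k : ℤ => B * (1 / (k : ℝ) ^ 2) :=
    (Real.summable_one_div_int_pow.2 one_lt_two).mul_left B
  refine Summable.of_norm_bounded_eventually hs ?_
  filter_upwards [(Set.finite_singleton (0 : ℤ)).compl_mem_cofinite] with k hk
  have hk : k ≠ 0 := hk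
  rw [norm_norm, fc_eq_fc_deriv_div hf hc' hp hk, fc_eq_fc_deriv_div hf' hf'' hp' hk, norm_div,
    norm_div, norm_mul, Complex.norm_I, Complex.norm_intCast, one_mul, div_div, ← sq, sq_abs,
    div_eq_mul_one_div]
  gcongr
  exact norm_fc_le k

lemma tsum_natAbs_mul_enorm_fc_sq_lt_top {f f' : ℝ → ℂ} (hf : ∀ x, HasDerivAt f (f' x) x)
    (hf' : Continuous f') (hp : Function.Periodic f (2 * π)) (hs : Summable fun k => ‖fc f k‖) :
    ∑' k : ℤ, (k.natAbs : ℝ≥0∞) * ‖fc f k‖ₑ ^ 2 < ⊤ := by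
  set B := 1 / (2 * π) * ∫ x in circ, ‖f' x‖ with hB
  have hB0 : 0 ≤ B := (norm_nonneg _).trans (norm_fc_le (u := f') 0)
  have hle : ∀ k : ℤ, (k.natAbs : ℝ≥0∞) * ‖fc f k‖ₑ ^ 2 ≤ ENNReal.ofReal (B * ‖fc f k‖) := by
    intro k
    rw [enorm_sq_eq_ofReal, ← ENNReal.ofReal_natCast, ← ENNReal.ofReal_mul (by positivity)]
    refine ENNReal.ofReal_le_ofReal ?_
    rcases eq_or_ne k 0 with rfl | hk
    · simp; positivity
    · have h1 : (k.natAbs : ℝ) * ‖fc f k‖ = ‖fc f' k‖ := by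
        have hk0 : |(k : ℝ)| ≠ 0 := by simpa using hk
        rw [fc_eq_fc_deriv_div hf hf' hp hk, norm_div, norm_mul, Complex.norm_I,
          Complex.norm_intCast, one_mul, Nat.cast_natAbs, Int.cast_abs]
        field_simp
      rw [sq, ← mul_assoc, h1]
      gcongr
      exact norm_fc_le k
  refine (ENNReal.tsum_le_tsum hle).trans_lt ?_
  rw [← ENNReal.ofReal_tsum_of_nonneg (fun k => by positivity) (hs.mul_left B)]
  exact ENNReal.ofReal_lt_top

lemma hasSum_fc_mul_expC {f : ℝ → ℂ} (hc : Continuous f) (hp : Function.Periodic f (2 * π))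
    (hs : Summable fun k => ‖fc f k‖) (x : ℝ) :
    HasSum (fun k => fc f k * expC k x) (f x) := by
  have : Fact (0 < 2 * π) := ⟨two_pi_pos⟩
  let F : C(AddCircle (2 * π), ℂ) := ⟨hp.lift, continuous_coinduced_dom.2 hc⟩
  have e : ∀ k (y : ℝ), fourier (T := 2 * π) k (y : AddCircle (2 * π)) = expC k y := by
    intro k y
    have hpi0 : (π : ℂ) ≠ 0 := by exact_mod_cast pi_ne_zero
    rw [fourier_coe_apply, expC]
    congr 1
    push_cast
    field_simp
  have hF : ∀ k, fourierCoeff F k = fc f k := by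
    intro k
    rw [fourierCoeff_eq_intervalIntegral _ _ (-π), fc, intervalIntegral.integral_of_le
      (by linarith [pi_pos]), ← circ_eq, Complex.real_smul]
    congr 1
    refine setIntegral_congr_fun measurableSet_circ fun y _ => ?_
    simp only [e, exp_neg_eq_expC, smul_eq_mul]
    rw [mul_comm]
    rfl
  have h : HasSum _ (f x) := has_pointwise_sum_fourier_series_of_summable (f := F)
    (hs.of_norm.congr fun k => (hF k).symm) x
  simpa only [hF, e, smul_eq_mul] using h

/-- The squared norm of `F` in `L²_od`. -/
def fieldEnergy (F : ℝ → ℝ → ℝ) : ℝ≥0∞ :=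
  ∫⁻ x in circ, ∫⁻ y in circ, ENNReal.ofReal (F x y ^ 2 / cd x y)

/-- The product measure on the torus `S¹ × S¹`. -/
abbrev torus : Measure (ℝ × ℝ) := (volume.restrict circ).prod (volume.restrict circ)

/-- The integrand `F(x,y) W(x,y) / |x-y|^{3/2}`. -/
def pairingIntegrand (F : ℝ → ℝ → ℝ) (W : ℝ → ℝ → ℂ) (p : ℝ × ℝ) : ℂ :=
  ((F p.1 p.2 / cd p.1 p.2 ^ ((3 : ℝ) / 2) : ℝ) : ℂ) * W p.1 p.2

lemma enorm_pairingIntegrand (F : ℝ → ℝ → ℝ) (W : ℝ → ℝ → ℂ) (p : ℝ × ℝ) :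
    ‖pairingIntegrand F W p‖ₑ
      = ‖F p.1 p.2 / √(cd p.1 p.2)‖ₑ * ‖W p.1 p.2 / (cd p.1 p.2 : ℂ)‖ₑ := by
  have hc := cd_nonneg p.1 p.2
  have e : cd p.1 p.2 ^ ((3 : ℝ) / 2) = √(cd p.1 p.2) * cd p.1 p.2 := by
    rcases hc.eq_or_lt with h | h
    · rw [← h, Real.zero_rpow (by norm_num)]; simp
    · rw [Real.sqrt_eq_rpow, ← Real.rpow_add_one h.ne']; norm_num
  rw [← ofReal_norm, ← ofReal_norm, ← ofReal_norm, ← ENNReal.ofReal_mul (norm_nonneg _)]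
  congr 1
  rw [pairingIntegrand, norm_mul, Complex.norm_real, norm_div, norm_div, norm_div, e, norm_mul,
    Complex.norm_real]
  ring

lemma measurable_pairingIntegrand {F : ℝ → ℝ → ℝ} (hF : Measurable (Function.uncurry F))
    {W : ℝ → ℝ → ℂ} (hW : Measurable (Function.uncurry W)) :
    Measurable (pairingIntegrand F W) := by
  have h1 : Measurable fun p : ℝ × ℝ => F p.1 p.2 / cd p.1 p.2 ^ ((3 : ℝ) / 2) :=
    Measurable.div hF (continuous_cd.measurable.pow_const _)
  exact (Complex.measurable_ofReal.comp h1).mul hW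

lemma lintegral_enorm_pairingIntegrand_le {F : ℝ → ℝ → ℝ} (hF : Measurable (Function.uncurry F))
    {W : ℝ → ℝ → ℂ} (hW : Measurable (Function.uncurry W)) :
    ∫⁻ p, ‖pairingIntegrand F W p‖ₑ ∂torus
      ≤ fieldEnergy F ^ ((1 : ℝ) / 2) * chordEnergy W ^ ((1 : ℝ) / 2) := by
  have h1 : Measurable fun p : ℝ × ℝ => ‖F p.1 p.2 / √(cd p.1 p.2)‖ₑ :=
    (Measurable.div hF continuous_cd.measurable.sqrt).enorm
  have h2 : Measurable fun p : ℝ × ℝ => ‖W p.1 p.2 / (cd p.1 p.2 : ℂ)‖ₑ :=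
    (measurable_div_cd hW).enorm
  simp_rw [enorm_pairingIntegrand]
  refine (ENNReal.lintegral_mul_le_Lp_mul_Lq torus Real.HolderConjugate.two_two
    h1.aemeasurable h2.aemeasurable).trans_eq ?_
  congr 2
  · rw [fieldEnergy, lintegral_prod _ (h1.pow_const _).aemeasurable]
    refine lintegral_congr fun x => lintegral_congr fun y => ?_
    rw [ENNReal.rpow_two, ← ofReal_norm, ← ENNReal.ofReal_pow (norm_nonneg _), Real.norm_eq_abs,
      sq_abs, div_pow, Real.sq_sqrt (cd_nonneg _ _)]
  · rw [chordEnergy, lintegral_prod _ (h2.pow_const _).aemeasurable]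
    simp_rw [ENNReal.rpow_two]

lemma integrable_pairingIntegrand {F : ℝ → ℝ → ℝ} (hF : Measurable (Function.uncurry F))
    (hFE : fieldEnergy F < ⊤) {W : ℝ → ℝ → ℂ} (hW : Measurable (Function.uncurry W))
    (hWE : chordEnergy W < ⊤) : Integrable (pairingIntegrand F W) torus := by
  refine ⟨(measurable_pairingIntegrand hF hW).aestronglyMeasurable,
    (lintegral_enorm_pairingIntegrand_le hF hW).trans_lt ?_⟩
  exact ENNReal.mul_lt_top (ENNReal.rpow_lt_top_of_nonneg (by norm_num) hFE.ne)
    (ENNReal.rpow_lt_top_of_nonneg (by norm_num) hWE.ne)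

lemma enorm_integral_pairingIntegrand_le {F : ℝ → ℝ → ℝ} (hF : Measurable (Function.uncurry F))
    {W : ℝ → ℝ → ℂ} (hW : Measurable (Function.uncurry W)) :
    ‖∫ p, pairingIntegrand F W p ∂torus‖ₑ
      ≤ fieldEnergy F ^ ((1 : ℝ) / 2) * chordEnergy W ^ ((1 : ℝ) / 2) :=
  le_trans (enorm_integral_le_lintegral_enorm (pairingIntegrand F W))
    (lintegral_enorm_pairingIntegrand_le hF hW)

lemma chordEnergy_mul_le {w : ℝ → ℂ} {B : ℝ≥0∞} (hw : ∀ x, ‖w x‖ₑ ≤ B) {W : ℝ → ℝ → ℂ}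
    (hW : Measurable (Function.uncurry W)) :
    chordEnergy (fun x y => w x * W x y) ≤ B ^ 2 * chordEnergy W := by
  have hm : Measurable fun p : ℝ × ℝ => ‖W p.1 p.2 / (cd p.1 p.2 : ℂ)‖ₑ ^ 2 :=
    (measurable_div_cd hW).enorm.pow_const 2
  have hm₁ : ∀ x, Measurable fun y => ‖W x y / (cd x y : ℂ)‖ₑ ^ 2 := fun x => by
    have := hm.comp (measurable_prodMk_left (x := x))
    exact this
  have hm₂ : Measurable fun x => ∫⁻ y in circ, ‖W x y / (cd x y : ℂ)‖ₑ ^ 2 :=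
    hm.lintegral_prod_right'
  rw [chordEnergy, chordEnergy, ← lintegral_const_mul _ hm₂]
  refine lintegral_mono fun x => ?_
  simp only
  rw [← lintegral_const_mul _ (hm₁ x)]
  refine lintegral_mono fun y => ?_
  simp only
  rw [mul_div_assoc, enorm_mul, mul_pow]
  gcongr
  exact hw x

lemma Measurable.uncurry_swap {W : ℝ → ℝ → ℂ} (hW : Measurable (Function.uncurry W)) :
    Measurable (Function.uncurry fun x y => W y x) := by
  have := hW.comp measurable_swap
  exact this

lemma measurable_diff {u : ℝ → ℂ} (hu : Measurable u) :
    Measurable (Function.uncurry fun x y => u x - u y) :=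
  (hu.comp measurable_fst).sub (hu.comp measurable_snd)

lemma measurable_mul_diff {w u : ℝ → ℂ} (hw : Measurable w) (hu : Measurable u) :
    Measurable (Function.uncurry fun x y => w x * (u x - u y)) :=
  (hw.comp measurable_fst).mul (measurable_diff hu)

lemma chordEnergy_expC_lt_top (j k : ℤ) :
    chordEnergy (fun x y => expC j x * (expC k x - expC k y)) < ⊤ := by
  have h := chordEnergy_trig_le {(j, k)} fun _ => 1
  simp only [Finset.sum_singleton, one_mul] at h
  refine h.trans_lt ?_
  simp [lt_top_iff_ne_top, ENNReal.mul_eq_top]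

lemma pairingIntegrand_sum {ι : Type*} (F : ℝ → ℝ → ℝ) (s : Finset ι) (c : ι → ℂ)
    (W : ι → ℝ → ℝ → ℂ) (p : ℝ × ℝ) :
    pairingIntegrand F (fun x y => ∑ i ∈ s, c i * W i x y) p
      = ∑ i ∈ s, c i * pairingIntegrand F (W i) p := by
  simp only [pairingIntegrand, Finset.mul_sum]
  exact Finset.sum_congr rfl fun i _ => by ring

lemma integral_pairingIntegrand_sum {ι : Type*} {F : ℝ → ℝ → ℝ} (s : Finset ι) (c : ι → ℂ)
    {W : ι → ℝ → ℝ → ℂ} (hW : ∀ i ∈ s, Integrable (pairingIntegrand F (W i)) torus) :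
    ∫ p, pairingIntegrand F (fun x y => ∑ i ∈ s, c i * W i x y) p ∂torus
      = ∑ i ∈ s, c i * ∫ p, pairingIntegrand F (W i) p ∂torus := by
  simp_rw [pairingIntegrand_sum]
  rw [integral_finsetSum _ fun i hi => (hW i hi).const_mul _]
  simp_rw [integral_const_mul]

/-- `F` is half-divergence free in the weak sense. -/
def HalfDivFree (F : ℝ → ℝ → ℝ) : Prop :=
  ∀ φ : ℝ → ℝ, ContDiff ℝ (⊤ : ℕ∞) φ → Function.Periodic φ (2 * π) →
    (∫ x in circ, ∫ y in circ, F x y * (φ x - φ y) / cd x y ^ ((3 : ℝ) / 2)) = 0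

lemma chordEnergy_expC_diff_lt_top (n : ℤ) :
    chordEnergy (fun x y => expC n x - expC n y) < ⊤ := by
  simpa [expC_zero] using chordEnergy_expC_lt_top 0 n

lemma expC_re (n : ℤ) (x : ℝ) : (expC n x).re = Real.cos (n * x) := by
  have : Complex.I * (n : ℂ) * (x : ℂ) = ((n * x : ℝ) : ℂ) * Complex.I := by push_cast; ring
  rw [expC, this, Complex.exp_ofReal_mul_I_re]

lemma expC_im (n : ℤ) (x : ℝ) : (expC n x).im = Real.sin (n * x) := by
  have : Complex.I * (n : ℂ) * (x : ℂ) = ((n * x : ℝ) : ℂ) * Complex.I := by push_cast; ring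
  rw [expC, this, Complex.exp_ofReal_mul_I_im]

lemma integral_pairingIntegrand_expC_diff {F : ℝ → ℝ → ℝ} (hF : Measurable (Function.uncurry F))
    (hFE : fieldEnergy F < ⊤) (hdiv : HalfDivFree F) (n : ℤ) :
    ∫ p, pairingIntegrand F (fun x y => expC n x - expC n y) p ∂torus = 0 := by
  have hi := integrable_pairingIntegrand hF hFE (measurable_diff (continuous_expC n).measurable)
    (chordEnergy_expC_diff_lt_top n)
  have hre := hi.re
  have him := hi.im
  refine Complex.ext ?_ ?_
  · have h1 := integral_re hi
    simp only [RCLike.re_eq_complex_re] at h1 hre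
    rw [← h1, integral_prod _ hre, Complex.zero_re]
    refine Eq.trans ?_ (hdiv (fun x => (expC n x).re) (by simp_rw [expC_re]; fun_prop)
      fun x => by simp only [periodic_expC n x])
    congr with x
    congr with y
    simp only [pairingIntegrand, Complex.re_ofReal_mul, Complex.sub_re]
    ring
  · have h1 := integral_im hi
    simp only [RCLike.im_eq_complex_im] at h1 him
    rw [← h1, integral_prod _ him, Complex.zero_im]
    refine Eq.trans ?_ (hdiv (fun x => (expC n x).im) (by simp_rw [expC_im]; fun_prop)
      fun x => by simp only [periodic_expC n x])
    congr with x
    congr with y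
    simp only [pairingIntegrand, Complex.im_ofReal_mul, Complex.sub_im]
    ring

/-- The Wente estimate for trigonometric polynomials. -/
lemma enorm_integral_pairingIntegrand_trig_le {F : ℝ → ℝ → ℝ}
    (hF : Measurable (Function.uncurry F)) (hFE : fieldEnergy F < ⊤) (hdiv : HalfDivFree F)
    (s : Finset ℤ) (a b : ℤ → ℂ) :
    ‖∫ p, pairingIntegrand F (fun x y => ∑ q ∈ s ×ˢ s,
        (a q.1 * b q.2) * (expC q.1 x * (expC q.2 x - expC q.2 y))) p ∂torus‖ₑ
      ≤ 2 * (fieldEnergy F ^ ((1 : ℝ) / 2) * (4 * ENNReal.ofReal (2 * π) ^ 2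
        * ((∑' k : ℤ, (k.natAbs : ℝ≥0∞) * ‖a k‖ₑ ^ 2)
          * ∑' k : ℤ, (k.natAbs : ℝ≥0∞) * ‖b k‖ₑ ^ 2)) ^ ((1 : ℝ) / 2)) := by
  classical
  set e : ℤ × ℤ → ℝ → ℝ → ℂ := fun q x y => expC q.1 x * (expC q.2 x - expC q.2 y) with he
  have hem : ∀ q, Measurable (Function.uncurry (e q)) := fun q =>
    measurable_mul_diff (continuous_expC _).measurable (continuous_expC _).measurable
  have hei : ∀ q, Integrable (pairingIntegrand F (e q)) torus := fun q =>
    integrable_pairingIntegrand hF hFE (hem q) (chordEnergy_expC_lt_top _ _)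
  have hei' : ∀ q, Integrable (pairingIntegrand F (fun x y => e q y x)) torus := fun q =>
    integrable_pairingIntegrand hF hFE (hem q |>.uncurry_swap)
      (by rw [chordEnergy_swap (hem q)]; exact chordEnergy_expC_lt_top _ _)
  have hswap : ∀ q : ℤ × ℤ, ∫ p, pairingIntegrand F (e q) p ∂torus
      = ∫ p, pairingIntegrand F (fun x y => e q.swap y x) p ∂torus := by
    intro q
    rw [← sub_eq_zero, ← integral_sub (hei q) (hei' q.swap),
      ← integral_pairingIntegrand_expC_diff hF hFE hdiv (q.1 + q.2)]
    congr 1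
    ext p
    simp only [pairingIntegrand, he, Prod.fst_swap, Prod.snd_swap, expC_add]
    ring
  set c : ℤ × ℤ → ℂ := fun q => a q.1 * b q.2 with hc
  set S₁ := (s ×ˢ s).filter fun q => q.2.natAbs ≤ q.1.natAbs with hS₁
  set S₂ := (s ×ˢ s).filter fun q => ¬ q.2.natAbs ≤ q.1.natAbs with hS₂
  set S₂' := S₂.image Prod.swap with hS₂'
  set Y := (∑' k : ℤ, (k.natAbs : ℝ≥0∞) * ‖a k‖ₑ ^ 2)
          * ∑' k : ℤ, (k.natAbs : ℝ≥0∞) * ‖b k‖ₑ ^ 2 with hY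
  have hsumY : ∑ q ∈ s ×ˢ s, ((q.1.natAbs : ℝ≥0∞) * q.2.natAbs) * ‖c q‖ₑ ^ 2 ≤ Y := by
    calc _ = (∑ j ∈ s, (j.natAbs : ℝ≥0∞) * ‖a j‖ₑ ^ 2)
          * ∑ k ∈ s, (k.natAbs : ℝ≥0∞) * ‖b k‖ₑ ^ 2 := by
          rw [Finset.sum_mul_sum, ← Finset.sum_product']
          refine Finset.sum_congr rfl fun q _ => ?_
          rw [hc, enorm_mul, mul_pow]; ring
      _ ≤ Y := mul_le_mul' (ENNReal.sum_le_tsum _) (ENNReal.sum_le_tsum _)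
  have split : ∫ p, pairingIntegrand F (fun x y => ∑ q ∈ s ×ˢ s, c q * e q x y) p ∂torus
      = ∫ p, pairingIntegrand F (fun x y => ∑ q ∈ S₁, c q * e q x y) p ∂torus
        + ∫ p, pairingIntegrand F (fun x y => ∑ q ∈ S₂', c q.swap * e q y x) p ∂torus := by
    rw [integral_pairingIntegrand_sum _ _ fun q _ => hei q,
      integral_pairingIntegrand_sum _ _ fun q _ => hei q,
      integral_pairingIntegrand_sum _ (fun q => c q.swap) (W := fun q x y => e q y x)
        fun q _ => hei' q,
      ← Finset.sum_filter_add_sum_filter_not (s ×ˢ s) fun q => q.2.natAbs ≤ q.1.natAbs, hS₂',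
      Finset.sum_image Prod.swap_injective.injOn]
    simp_rw [Prod.swap_swap, ← hswap]
    rfl
  have hm₁ : Measurable (Function.uncurry fun x y => ∑ q ∈ S₁, c q * e q x y) :=
    Finset.measurable_fun_sum _ fun q _ => (hem q).const_mul _
  have hm₂ : Measurable (Function.uncurry fun x y => ∑ q ∈ S₂', c q.swap * e q x y) :=
    Finset.measurable_fun_sum _ fun q _ => (hem q).const_mul _
  have hm₂' : Measurable (Function.uncurry fun x y => ∑ q ∈ S₂', c q.swap * e q y x) :=
    hm₂.uncurry_swap
  have h₁ : chordEnergy (fun x y => ∑ q ∈ S₁, c q * e q x y)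
      ≤ 4 * ENNReal.ofReal (2 * π) ^ 2 * Y := by
    refine (chordEnergy_trig_le S₁ c).trans ?_
    gcongr
    refine le_trans ?_ hsumY
    refine le_trans (Finset.sum_le_sum fun q hq => ?_)
      (Finset.sum_le_sum_of_subset (Finset.filter_subset _ _))
    rw [sq (q.2.natAbs : ℝ≥0∞)]
    gcongr
    exact (Finset.mem_filter.1 hq).2
  have h₂ : chordEnergy (fun x y => ∑ q ∈ S₂', c q.swap * e q y x)
      ≤ 4 * ENNReal.ofReal (2 * π) ^ 2 * Y := by
    rw [chordEnergy_swap hm₂]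
    refine (chordEnergy_trig_le S₂' fun q => c q.swap).trans ?_
    rw [hS₂', Finset.sum_image Prod.swap_injective.injOn]
    gcongr
    refine le_trans ?_ hsumY
    refine le_trans (Finset.sum_le_sum fun q hq => ?_)
      (Finset.sum_le_sum_of_subset (Finset.filter_subset _ _))
    rw [Prod.snd_swap, Prod.swap_swap, sq (q.1.natAbs : ℝ≥0∞)]
    gcongr
    exact (not_le.1 (Finset.mem_filter.1 hq).2).le
  rw [split, two_mul]
  refine (enorm_add_le _ _).trans ?_
  gcongr
  · refine (enorm_integral_pairingIntegrand_le hF hm₁).trans ?_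
    gcongr
  · refine (enorm_integral_pairingIntegrand_le hF hm₂').trans ?_
    gcongr

lemma enorm_sum_mul_expC_le (s : Finset ℤ) (a : ℤ → ℂ) (x : ℝ) :
    ‖∑ k ∈ s, a k * expC k x‖ₑ ≤ ∑' k, ‖a k‖ₑ := by
  refine (enorm_sum_le _ _).trans (le_trans (Finset.sum_le_sum fun k _ => ?_)
    (ENNReal.sum_le_tsum s))
  rw [enorm_mul, ← ofReal_norm (expC k x), norm_expC, ENNReal.ofReal_one, mul_one]

lemma enorm_sub_sum_mul_expC_le {a : ℤ → ℂ} {x : ℝ} {z : ℂ}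
    (h : HasSum (fun k => a k * expC k x) z) (s : Finset ℤ) :
    ‖z - ∑ k ∈ s, a k * expC k x‖ₑ ≤ ∑' k : {k // k ∉ s}, ‖a k‖ₑ := by
  have h' : HasSum (fun k : {k // k ∉ s} => a k * expC k x) (z - ∑ k ∈ s, a k * expC k x) :=
    (s.hasSum_compl_iff (f := fun k => a k * expC k x)).2 (by simpa using h)
  rw [← h'.tsum_eq]
  refine enorm_tsum_le_tsum_enorm.trans (ENNReal.tsum_le_tsum fun k => ?_)
  rw [enorm_mul, ← ofReal_norm (expC k x), norm_expC, ENNReal.ofReal_one, mul_one]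

lemma continuous_sum_mul_expC (s : Finset ℤ) (a : ℤ → ℂ) :
    Continuous fun x => ∑ k ∈ s, a k * expC k x :=
  continuous_finsetSum _ fun _ _ => continuous_const.mul (continuous_expC _)

lemma chordEnergy_sub_partialSum_le {u : ℝ → ℂ} (hm : Measurable u)
    (hu : Function.Periodic u (2 * π)) (h2 : MemLp u 2 (volume.restrict circ)) (s : Finset ℤ) :
    chordEnergy (fun x y => (u x - ∑ k ∈ s, fc u k * expC k x)
        - (u y - ∑ k ∈ s, fc u k * expC k y))
      ≤ ENNReal.ofReal (2 * π) ^ 2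
        * ∑' k : {k // k ∉ s}, ((k : ℤ).natAbs : ℝ≥0∞) * ‖fc u k‖ₑ ^ 2 := by
  have hc := continuous_sum_mul_expC s (fc u)
  have hp : Function.Periodic (fun x => u x - ∑ k ∈ s, fc u k * expC k x) (2 * π) := fun x => by
    simp only [hu x, periodic_expC _ x]
  refine (chordEnergy_sub_le (u := fun x => u x - ∑ k ∈ s, fc u k * expC k x)
    (hm.sub hc.measurable) hp (h2.sub (hc.memLp_circ 2))).trans_eq ?_
  congr 1
  refine Eq.trans ?_ (tsum_subtype {k : ℤ | k ∉ s}
    fun k => (k.natAbs : ℝ≥0∞) * ‖fc u k‖ₑ ^ 2).symm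
  refine tsum_congr fun k => ?_
  rw [fc_sub (h2.integrable one_le_two) hc.integrableOn_circ, show
    fc (fun x => ∑ k ∈ s, fc u k * expC k x) k = _ from fc_trig s (fc u) id k]
  by_cases hk : k ∈ s <;> simp [hk, Set.indicator]

/-- The Wente estimate for a test function with absolutely summable Fourier series. -/
lemma enorm_integral_pairingIntegrand_mul_diff_le {F : ℝ → ℝ → ℝ}
    (hF : Measurable (Function.uncurry F)) (hFE : fieldEnergy F < ⊤) (hdiv : HalfDivFree F)
    {φ g : ℝ → ℂ} (hφ : Continuous φ) (hφp : Function.Periodic φ (2 * π))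
    (hφs : Summable fun k => ‖fc φ k‖) (hg : Measurable g) (hgp : Function.Periodic g (2 * π))
    (hg2 : MemLp g 2 (volume.restrict circ))
    (hgE : ∑' k : ℤ, (k.natAbs : ℝ≥0∞) * ‖fc g k‖ₑ ^ 2 < ⊤) :
    Integrable (pairingIntegrand F fun x y => φ x * (g x - g y)) torus ∧
    ‖∫ p, pairingIntegrand F (fun x y => φ x * (g x - g y)) p ∂torus‖ₑ
      ≤ 2 * (fieldEnergy F ^ ((1 : ℝ) / 2) * (4 * ENNReal.ofReal (2 * π) ^ 2
        * ((∑' k : ℤ, (k.natAbs : ℝ≥0∞) * ‖fc φ k‖ₑ ^ 2)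
          * ∑' k : ℤ, (k.natAbs : ℝ≥0∞) * ‖fc g k‖ₑ ^ 2)) ^ ((1 : ℝ) / 2)) := by
  set A := ∑' k, ‖fc φ k‖ₑ with hA
  have hAtop : A ≠ ⊤ := tsum_enorm_ne_top_iff_summable_norm.2 hφs
  set φs : Finset ℤ → ℝ → ℂ := fun s x => ∑ k ∈ s, fc φ k * expC k x with hφs_def
  set gs : Finset ℤ → ℝ → ℂ := fun s x => ∑ k ∈ s, fc g k * expC k x with hgs_def
  have hφsum := hasSum_fc_mul_expC hφ hφp hφs
  have hφA : ∀ x, ‖φ x‖ₑ ≤ A := fun x => by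
    simpa using (enorm_sub_sum_mul_expC_le (hφsum x) ∅).trans
      (ENNReal.tsum_comp_le_tsum_of_injective Subtype.val_injective fun k => ‖fc φ k‖ₑ)
  set G := chordEnergy fun x y => g x - g y with hG
  have hGtop : G < ⊤ := (chordEnergy_sub_le hg hgp hg2).trans_lt
    (ENNReal.mul_lt_top (ENNReal.pow_lt_top ENNReal.ofReal_lt_top) hgE)
  have hgd := measurable_diff hg
  have hφm := hφ.measurable
  have hφsm : ∀ s, Measurable (φs s) := fun s => (continuous_sum_mul_expC s _).measurable
  have hgsm : ∀ s, Measurable (gs s) := fun s => (continuous_sum_mul_expC s _).measurable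
  set ε : Finset ℤ → ℝ≥0∞ := fun s => ∑' k : {k // k ∉ s}, ‖fc φ k‖ₑ with hε
  set δ : Finset ℤ → ℝ≥0∞ := fun s =>
    ∑' k : {k // k ∉ s}, ((k : ℤ).natAbs : ℝ≥0∞) * ‖fc g k‖ₑ ^ 2 with hδ
  have hε0 : Tendsto ε atTop (𝓝 0) := ENNReal.tendsto_tsum_compl_atTop_zero hAtop
  have hδ0 : Tendsto δ atTop (𝓝 0) := ENNReal.tendsto_tsum_compl_atTop_zero hgE.ne
  have hm₁ : ∀ s, Measurable (Function.uncurry fun x y =>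
      φs s x * ((g x - gs s x) - (g y - gs s y))) := fun s =>
    measurable_mul_diff (hφsm s) (hg.sub (hgsm s))
  have hm₂ : ∀ s, Measurable (Function.uncurry fun x y => (φ x - φs s x) * (g x - g y)) :=
    fun s => measurable_mul_diff (hφm.sub (hφsm s)) hg
  have hE₁ : ∀ s, chordEnergy (fun x y => φs s x * ((g x - gs s x) - (g y - gs s y)))
      ≤ A ^ 2 * (ENNReal.ofReal (2 * π) ^ 2 * δ s) := fun s =>
    (chordEnergy_mul_le (enorm_sum_mul_expC_le s (fc φ))
      (measurable_diff (hg.sub (hgsm s)))).trans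
      (mul_le_mul_right (chordEnergy_sub_partialSum_le hg hgp hg2 s) _)
  have hE₂ : ∀ s, chordEnergy (fun x y => (φ x - φs s x) * (g x - g y)) ≤ ε s ^ 2 * G :=
    fun s => chordEnergy_mul_le (fun x => enorm_sub_sum_mul_expC_le (hφsum x) s) hgd
  have hi : Integrable (pairingIntegrand F fun x y => φ x * (g x - g y)) torus :=
    integrable_pairingIntegrand hF hFE (measurable_mul_diff hφm hg)
      ((chordEnergy_mul_le hφA hgd).trans_lt
        (ENNReal.mul_lt_top (ENNReal.pow_lt_top hAtop.lt_top) hGtop))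
  refine ⟨hi, ?_⟩
  set E₀ := fieldEnergy F ^ ((1 : ℝ) / 2) with hE₀
  have hE₀top : E₀ ≠ ⊤ := (ENNReal.rpow_lt_top_of_nonneg (by norm_num) hFE.ne).ne
  set Y := 2 * (E₀ * (4 * ENNReal.ofReal (2 * π) ^ 2
        * ((∑' k : ℤ, (k.natAbs : ℝ≥0∞) * ‖fc φ k‖ₑ ^ 2)
          * ∑' k : ℤ, (k.natAbs : ℝ≥0∞) * ‖fc g k‖ₑ ^ 2)) ^ ((1 : ℝ) / 2)) with hY
  have hlim : Tendsto (fun s => E₀ * (A ^ 2 * (ENNReal.ofReal (2 * π) ^ 2 * δ s)) ^ ((1 : ℝ) / 2)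
      + E₀ * (ε s ^ 2 * G) ^ ((1 : ℝ) / 2) + Y) atTop (𝓝 Y) := by
    have h₁ := ENNReal.Tendsto.const_mul (a := E₀) (ENNReal.Tendsto.const_mul (a := A ^ 2)
      (ENNReal.Tendsto.const_mul (a := ENNReal.ofReal (2 * π) ^ 2) hδ0
        (Or.inr (ENNReal.pow_ne_top ENNReal.ofReal_ne_top)))
        (Or.inr (ENNReal.pow_ne_top hAtop)) |>.ennrpow_const ((1 : ℝ) / 2)) (Or.inr hE₀top)
    have h₂ := ENNReal.Tendsto.const_mul (a := E₀) ((ENNReal.Tendsto.mul_const (b := G)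
      (ENNReal.Tendsto.pow (n := 2) hε0) (Or.inr hGtop.ne)).ennrpow_const ((1 : ℝ) / 2))
      (Or.inr hE₀top)
    have h₃ := (h₁.add h₂).add_const Y
    simpa using h₃
  refine ge_of_tendsto' hlim fun s => ?_
  have hfin₁ : A ^ 2 * (ENNReal.ofReal (2 * π) ^ 2 * δ s) < ⊤ :=
    ENNReal.mul_lt_top (ENNReal.pow_lt_top hAtop.lt_top)
      (ENNReal.mul_lt_top (ENNReal.pow_lt_top ENNReal.ofReal_lt_top)
        ((ENNReal.tsum_comp_le_tsum_of_injective Subtype.val_injective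
          fun k : ℤ => (k.natAbs : ℝ≥0∞) * ‖fc g k‖ₑ ^ 2).trans_lt hgE))
  have hfin₂ : ε s ^ 2 * G < ⊤ :=
    ENNReal.mul_lt_top (ENNReal.pow_lt_top
      ((ENNReal.tsum_comp_le_tsum_of_injective Subtype.val_injective
        fun k : ℤ => ‖fc φ k‖ₑ).trans_lt hAtop.lt_top)) hGtop
  have hi₁ := integrable_pairingIntegrand hF hFE (hm₁ s) ((hE₁ s).trans_lt hfin₁)
  have hi₂ := integrable_pairingIntegrand hF hFE (hm₂ s) ((hE₂ s).trans_lt hfin₂)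
  have hsplit : pairingIntegrand F (fun x y => φs s x * (gs s x - gs s y))
      = fun p => pairingIntegrand F (fun x y => φ x * (g x - g y)) p
        - (pairingIntegrand F (fun x y => φs s x * ((g x - gs s x) - (g y - gs s y))) p
        + pairingIntegrand F (fun x y => (φ x - φs s x) * (g x - g y)) p) := by
    ext p
    simp only [pairingIntegrand]
    ring
  have hsum : ∫ p, pairingIntegrand F (fun x y => φ x * (g x - g y)) p ∂torus
      = ∫ p, pairingIntegrand F (fun x y => φs s x * ((g x - gs s x) - (g y - gs s y))) p ∂torus
        + ∫ p, pairingIntegrand F (fun x y => (φ x - φs s x) * (g x - g y)) p ∂torus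
        + ∫ p, pairingIntegrand F (fun x y => φs s x * (gs s x - gs s y)) p ∂torus := by
    rw [hsplit, integral_sub hi, integral_add hi₁ hi₂]
    · ring
    · exact hi₁.add hi₂
  have htrig : (fun x y => φs s x * (gs s x - gs s y)) = fun x y => ∑ q ∈ s ×ˢ s,
      (fc φ q.1 * fc g q.2) * (expC q.1 x * (expC q.2 x - expC q.2 y)) := by
    ext x y
    simp only [hφs_def, hgs_def]
    rw [← Finset.sum_sub_distrib, Finset.sum_mul_sum, ← Finset.sum_product']
    exact Finset.sum_congr rfl fun q _ => by ring
  rw [hsum]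
  refine (enorm_add_le _ _).trans (add_le_add ((enorm_add_le _ _).trans (add_le_add ?_ ?_)) ?_)
  · refine (enorm_integral_pairingIntegrand_le hF (hm₁ s)).trans ?_
    gcongr
    exact hE₁ s
  · refine (enorm_integral_pairingIntegrand_le hF (hm₂ s)).trans ?_
    gcongr
    exact hE₂ s
  · rw [htrig]
    exact enorm_integral_pairingIntegrand_trig_le hF hFE hdiv s (fc φ) (fc g)

lemma memLp_two_ofReal {g : ℝ → ℝ} (hg : Measurable g)
    (hg2 : ∫⁻ x in circ, (‖g x‖₊ : ℝ≥0∞) ^ 2 < ⊤) :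
    MemLp (fun x => (g x : ℂ)) 2 (volume.restrict circ) := by
  refine ⟨(Complex.measurable_ofReal.comp hg).aestronglyMeasurable, ?_⟩
  rw [eLpNorm_lt_top_iff_lintegral_rpow_enorm_lt_top two_ne_zero ENNReal.ofNat_ne_top]
  refine lt_of_eq_of_lt (lintegral_congr fun x => ?_) hg2
  rw [ENNReal.toReal_ofNat, ENNReal.rpow_two, ← enorm_eq_nnnorm, ← ofReal_norm, ← ofReal_norm,
    Complex.norm_real]

lemma hHalfR_le_hSobR (g : ℝ → ℝ) : hHalfR g ≤ hSobR (1 / 2) g := by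
  refine ENNReal.tsum_le_tsum fun k => ?_
  gcongr
  rw [← ENNReal.ofReal_natCast, ← Real.sqrt_eq_rpow]
  refine ENNReal.ofReal_le_ofReal (Real.le_sqrt_of_sq_le ?_)
  rw [Nat.cast_natAbs, Int.cast_abs, sq_abs]
  linarith

lemma hSobR_half_lt_top {g : ℝ → ℝ} (hg : Measurable g)
    (hg2 : ∫⁻ x in circ, (‖g x‖₊ : ℝ≥0∞) ^ 2 < ⊤) (hgE : hHalfR g < ⊤) :
    hSobR (1 / 2) g < ⊤ := by
  have hL := memLp_two_ofReal hg hg2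
  have hP : ∑' k : ℤ, (‖fcR g k‖₊ : ℝ≥0∞) ^ 2 < ⊤ := by
    have h := hL.2
    rw [eLpNorm_lt_top_iff_lintegral_rpow_enorm_lt_top two_ne_zero ENNReal.ofNat_ne_top] at h
    simp_rw [ENNReal.toReal_ofNat, ENNReal.rpow_two] at h
    rw [lintegral_circ_enorm_sq hL] at h
    exact ENNReal.lt_top_of_mul_ne_top_right h.ne (by simp [pi_pos])
  have hle : hSobR (1 / 2) g ≤ (∑' k : ℤ, (‖fcR g k‖₊ : ℝ≥0∞) ^ 2) + hHalfR g := by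
    rw [hHalfR, ← ENNReal.tsum_add]
    refine ENNReal.tsum_le_tsum fun k => ?_
    rw [← one_add_mul]
    gcongr
    rw [← ENNReal.ofReal_natCast, ← ENNReal.ofReal_one, ← ENNReal.ofReal_add zero_le_one
      (Nat.cast_nonneg _), ← Real.sqrt_eq_rpow]
    refine ENNReal.ofReal_le_ofReal (Real.sqrt_le_iff.2 ⟨by positivity, ?_⟩)
    rw [Nat.cast_natAbs, Int.cast_abs]
    nlinarith [sq_abs (k : ℝ), abs_nonneg (k : ℝ)]
  exact hle.trans_lt (ENNReal.add_lt_top.2 ⟨hP, hgE⟩)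

lemma integral_circ_mul_eq_pairing {F : ℝ → ℝ → ℝ} {φ g : ℝ → ℝ}
    (hi : Integrable (pairingIntegrand F fun x y => (φ x : ℂ) * ((g x : ℂ) - g y)) torus) :
    ((∫ x in circ, (∫ y in circ, F x y * (g x - g y) / cd x y ^ ((3 : ℝ) / 2)) * φ x : ℝ) : ℂ)
      = ∫ p, pairingIntegrand F (fun x y => (φ x : ℂ) * ((g x : ℂ) - g y)) p ∂torus := by
  have e : pairingIntegrand F (fun x y => (φ x : ℂ) * ((g x : ℂ) - g y))
      = fun p => ((F p.1 p.2 * (g p.1 - g p.2) / cd p.1 p.2 ^ ((3 : ℝ) / 2) * φ p.1 : ℝ) : ℂ) := by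
    ext p
    simp only [pairingIntegrand]
    push_cast
    ring
  rw [e] at hi ⊢
  have hr := hi.re
  simp only [RCLike.re_eq_complex_re, Complex.ofReal_re] at hr
  have h := integral_prod _ hr
  simp only [integral_mul_const] at h
  rw [← h]
  exact integral_ofReal.symm

/-- Fractional Wente-type estimate on the circle: if
`div_{1/2} F = 0` then `F·d_{1/2}g` minus a constant lies in `H^{-1/2}(S¹)` with
norm controlled by `‖F‖_{L²_od}‖g‖_{H^{1/2}}`. -/
theorem fractional_wente_circle :
    ∃ C : ℝ, 0 < C ∧
      ∀ F : ℝ → ℝ → ℝ, Measurable (Function.uncurry F) →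
        (∀ x y, F (x + 2 * π) y = F x y) → (∀ x y, F x (y + 2 * π) = F x y) →
        (∫⁻ x in circ, ∫⁻ y in circ, ENNReal.ofReal (F x y ^ 2 / cd x y)) < ⊤ →
        ∀ g : ℝ → ℝ, Measurable g → Function.Periodic g (2 * π) →
          (∫⁻ x in circ, (‖g x‖₊ : ℝ≥0∞) ^ 2) < ⊤ →
          hHalfR g < ⊤ →
          (∀ φ : ℝ → ℝ, ContDiff ℝ (⊤ : ℕ∞) φ → Function.Periodic φ (2 * π) →
            (∫ x in circ, ∫ y in circ, F x y * (φ x - φ y) / cd x y ^ ((3 : ℝ) / 2)) = 0) →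
          ∃ c : ℝ, ∀ φ : ℝ → ℝ, ContDiff ℝ (⊤ : ℕ∞) φ → Function.Periodic φ (2 * π) →
            |(∫ x in circ,
                (∫ y in circ, F x y * (g x - g y) / cd x y ^ ((3 : ℝ) / 2)) * φ x)
              - c * ∫ x in circ, φ x|
              ≤ C * ((∫⁻ x in circ, ∫⁻ y in circ,
                      ENNReal.ofReal (F x y ^ 2 / cd x y)) ^ ((1 : ℝ) / 2)).toReal
                * ((hSobR (1 / 2) g) ^ ((1 : ℝ) / 2)).toReal
                * ((hHalfR φ) ^ ((1 : ℝ) / 2)).toReal := by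
  refine ⟨8 * π, by positivity, fun F hF _ _ hFE g hg hgp hg2 hgE hdiv => ⟨0, fun φ hφ hφp => ?_⟩⟩
  rw [zero_mul, sub_zero]
  have hφ0 : ∀ x, HasDerivAt (fun x => (φ x : ℂ)) ((deriv φ x : ℝ) : ℂ) x := fun x =>
    (hφ.differentiable (by simp) x).hasDerivAt.ofReal_comp
  have hφ' : ContDiff ℝ (⊤ : ℕ∞) (deriv φ) := (contDiff_infty_iff_deriv.1 hφ).2
  have hφ1 : ∀ x, HasDerivAt (fun x => ((deriv φ x : ℝ) : ℂ)) ((deriv (deriv φ) x : ℝ) : ℂ) x := fun x =>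
    (hφ'.differentiable (by simp) x).hasDerivAt.ofReal_comp
  have hφ2 : Continuous fun x => ((deriv (deriv φ) x : ℝ) : ℂ) :=
    Complex.continuous_ofReal.comp (contDiff_infty_iff_deriv.1 hφ').2.continuous
  have hp0 : Function.Periodic (fun x => (φ x : ℂ)) (2 * π) := fun x => by simp only [hφp x]
  have hp1 : Function.Periodic (fun x => ((deriv φ x : ℝ) : ℂ)) (2 * π) := fun x => by
    have : deriv φ (x + 2 * π) = deriv φ x := by
      rw [← deriv_comp_add_const]; simp only [hφp _]
    simp only [this]
  have hs := summable_norm_fc hφ0 hφ1 hφ2 hp0 hp1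
  have hφE : hHalfR φ < ⊤ := tsum_natAbs_mul_enorm_fc_sq_lt_top hφ0
    (Complex.continuous_ofReal.comp hφ'.continuous) hp0 hs
  obtain ⟨hi, hle⟩ := enorm_integral_pairingIntegrand_mul_diff_le hF hFE hdiv
    (Complex.continuous_ofReal.comp hφ.continuous) hp0 hs (Complex.measurable_ofReal.comp hg)
    (fun x => by simp only [Function.comp, hgp x]) (memLp_two_ofReal hg hg2) hgE
  have hbridge := integral_circ_mul_eq_pairing hi
  have hle' : ENNReal.ofReal |∫ x in circ,
      (∫ y in circ, F x y * (g x - g y) / cd x y ^ ((3 : ℝ) / 2)) * φ x|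
      ≤ 2 * (fieldEnergy F ^ ((1 : ℝ) / 2) * (4 * ENNReal.ofReal (2 * π) ^ 2
        * (hHalfR φ * hSobR (1 / 2) g)) ^ ((1 : ℝ) / 2)) := by
    rw [← Real.norm_eq_abs, ← Complex.norm_real, hbridge, ofReal_norm]
    have h := hHalfR_le_hSobR g
    refine hle.trans ?_
    change 2 * (_ * (_ * (hHalfR φ * hHalfR g)) ^ ((1 : ℝ) / 2)) ≤ _
    gcongr
  have hroot : (4 * ENNReal.ofReal (2 * π) ^ 2) ^ ((1 : ℝ) / 2) = ENNReal.ofReal (4 * π) := by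
    have : 4 * ENNReal.ofReal (2 * π) ^ 2 = ENNReal.ofReal (4 * π) ^ (2 : ℝ) := by
      rw [ENNReal.rpow_two, ← ENNReal.ofReal_pow (by positivity),
        ← ENNReal.ofReal_pow (by positivity), show (4 : ℝ≥0∞) = ENNReal.ofReal 4 by simp,
        ← ENNReal.ofReal_mul (by norm_num)]
      congr 1; ring
    rw [this, ← ENNReal.rpow_mul]; norm_num
  rw [ENNReal.mul_rpow_of_nonneg (4 * _) _ (by norm_num), hroot,
    ENNReal.mul_rpow_of_nonneg (hHalfR φ) _ (by norm_num)] at hle'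
  have hfin : ∀ {z : ℝ≥0∞}, z < ⊤ → z ^ ((1 : ℝ) / 2) ≠ ⊤ := fun hz =>
    (ENNReal.rpow_lt_top_of_nonneg (by norm_num) hz.ne).ne
  have hb := ENNReal.toReal_mono (by
    refine ENNReal.mul_ne_top (by simp) (ENNReal.mul_ne_top (hfin hFE) (ENNReal.mul_ne_top
      ENNReal.ofReal_ne_top (ENNReal.mul_ne_top (hfin hφE)
        (hfin (hSobR_half_lt_top hg hg2 hgE)))))) hle'
  rw [ENNReal.toReal_ofReal (abs_nonneg _)] at hb
  simp only [ENNReal.toReal_mul, ENNReal.toReal_ofNat,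
    ENNReal.toReal_ofReal (show (0 : ℝ) ≤ 4 * π by positivity)] at hb
  refine hb.trans_eq ?_
  rw [fieldEnergy]
  ring
end
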